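/- Let R be a commutative ring, C a semidualizing R-module, and M an R-module belonging to the Bass class B_C. Then every augmented proper P_C-projective resolution of M is exact; in particular, every homomorphism φ : C ⊗_R P → M with P projective such that Hom_R(C ⊗_R Q, φ) is surjective for every projective module Q is itself surjective. -/

import Mathlib

open TensorProduct CategoryTheory

noncomputable section

/-- The natural evaluation map `ν_M : C ⊗_R Hom_R(C,M) → M`, `c ⊗ f ↦ f c`. -/
def evalNu (R : Type) [CommRing R] (C : Type) [AddCommGroup C] [Module R C]
    (M : Type) [AddCommGroup M] [Module R M] :
    (C ⊗[R] (C →ₗ[R] M)) →ₗ[R] M :=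
  TensorProduct.lift LinearMap.applyₗ

/-- The natural map `μ_M : M → Hom_R(C, C ⊗_R M)`, `m ↦ (c ↦ c ⊗ m)`. -/
def muMap (R : Type) [CommRing R] (C : Type) [AddCommGroup C] [Module R C]
    (M : Type) [AddCommGroup M] [Module R M] :
    M →ₗ[R] (C →ₗ[R] (C ⊗[R] M)) :=
  (TensorProduct.mk R C M).flip

/-- `Ext^i_R(A,B)`. -/
def extMod (R : Type) [CommRing R] (A : Type) [AddCommGroup A] [Module R A]
    (B : Type) [AddCommGroup B] [Module R B] (i : ℕ) : ModuleCat R :=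
  ((Ext R (ModuleCat R) i).obj (Opposite.op (ModuleCat.of R A))).obj (ModuleCat.of R B)

/-- `Tor_i^R(A,B)`. -/
def torMod (R : Type) [CommRing R] (A : Type) [AddCommGroup A] [Module R A]
    (B : Type) [AddCommGroup B] [Module R B] (i : ℕ) : ModuleCat R :=
  ((Tor (ModuleCat R) i).obj (ModuleCat.of R A)).obj (ModuleCat.of R B)

/-- A semidualizing module: `C` admits a degreewise finite projective resolution,
the homothety map `R → Hom_R(C,C)` is bijective, and `Ext^i_R(C,C) = 0` for `i ≥ 1`. -/
def IsSemidualizing (R : Type) [CommRing R] (C : Type) [AddCommGroup C] [Module R C] :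
    Prop :=
  (∃ (P : ℕ → ModuleCat.{0} R) (d : ∀ n, ↥(P (n + 1)) →ₗ[R] ↥(P n)) (ε : ↥(P 0) →ₗ[R] C),
      (∀ n, Module.Finite R ↥(P n)) ∧ (∀ n, Module.Projective R ↥(P n)) ∧
      Function.Surjective ε ∧ Function.Exact (d 0) ε ∧
      ∀ n, Function.Exact (d (n + 1)) (d n)) ∧
  Function.Bijective (fun r : R => (r • LinearMap.id : C →ₗ[R] C)) ∧
  ∀ i : ℕ, 1 ≤ i → Subsingleton (extMod R C C i)

/-- The Bass class `B_C`. -/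
def MemBassClass (R : Type) [CommRing R] (C : Type) [AddCommGroup C] [Module R C]
    (M : Type) [AddCommGroup M] [Module R M] : Prop :=
  (∀ i : ℕ, 1 ≤ i → Subsingleton (extMod R C M i)) ∧
  (∀ i : ℕ, 1 ≤ i → Subsingleton (torMod R C (C →ₗ[R] M) i)) ∧
  Function.Bijective (evalNu R C M)

/-- The Auslander class `A_C`. -/
def MemAuslanderClass (R : Type) [CommRing R] (C : Type) [AddCommGroup C] [Module R C]
    (M : Type) [AddCommGroup M] [Module R M] : Prop :=
  (∀ i : ℕ, 1 ≤ i → Subsingleton (torMod R C M i)) ∧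
  (∀ i : ℕ, 1 ≤ i → Subsingleton (extMod R C (C ⊗[R] M) i)) ∧
  Function.Bijective (muMap R C M)

/-- `X⁺ : ⋯ → C ⊗ P₁ → C ⊗ P₀ → M → 0` is an augmented proper `P_C`-projective resolution:
each `Pᵢ` is projective, it is a complex, and `Hom_R(C ⊗ Q, X⁺)` is exact for each
projective module `Q`. -/
def IsAugProperRes (R : Type) [CommRing R] (C : Type) [AddCommGroup C] [Module R C]
    (M : Type) [AddCommGroup M] [Module R M] (P : ℕ → ModuleCat.{0} R)
    (d : ∀ n : ℕ, (C ⊗[R] ↥(P (n + 1))) →ₗ[R] (C ⊗[R] ↥(P n)))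
    (ε : (C ⊗[R] ↥(P 0)) →ₗ[R] M) : Prop :=
  (∀ n, Module.Projective R ↥(P n)) ∧
  (∀ n, (d n).comp (d (n + 1)) = 0) ∧ (ε.comp (d 0) = 0) ∧
  ∀ (Q : Type) [AddCommGroup Q] [Module R Q], Module.Projective R Q →
    Function.Surjective (fun g : (C ⊗[R] Q) →ₗ[R] (C ⊗[R] ↥(P 0)) => ε.comp g) ∧
    Function.Exact (fun g : (C ⊗[R] Q) →ₗ[R] (C ⊗[R] ↥(P 1)) => (d 0).comp g)
      (fun g : (C ⊗[R] Q) →ₗ[R] (C ⊗[R] ↥(P 0)) => ε.comp g) ∧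
    ∀ n : ℕ, Function.Exact
      (fun g : (C ⊗[R] Q) →ₗ[R] (C ⊗[R] ↥(P (n + 2))) => (d (n + 1)).comp g)
      (fun g : (C ⊗[R] Q) →ₗ[R] (C ⊗[R] ↥(P (n + 1))) => (d n).comp g)

/-- Exactness of the augmented complex `⋯ → C ⊗ P₁ → C ⊗ P₀ → M → 0`. -/
def ResExact (R : Type) [CommRing R] (C : Type) [AddCommGroup C] [Module R C]
    (M : Type) [AddCommGroup M] [Module R M] (P : ℕ → ModuleCat.{0} R)
    (d : ∀ n : ℕ, (C ⊗[R] ↥(P (n + 1))) →ₗ[R] (C ⊗[R] ↥(P n)))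
    (ε : (C ⊗[R] ↥(P 0)) →ₗ[R] M) : Prop :=
  Function.Surjective ε ∧ Function.Exact (d 0) ε ∧
    ∀ n : ℕ, Function.Exact (d (n + 1)) (d n)

/-- Exactness of the augmented complex in all degrees `< n`
(`C ⊗ Pᵢ` in degree `i`, `M` in degree `-1`). -/
def ResExactLT (R : Type) [CommRing R] (C : Type) [AddCommGroup C] [Module R C]
    (M : Type) [AddCommGroup M] [Module R M] (P : ℕ → ModuleCat.{0} R)
    (d : ∀ n : ℕ, (C ⊗[R] ↥(P (n + 1))) →ₗ[R] (C ⊗[R] ↥(P n)))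
    (ε : (C ⊗[R] ↥(P 0)) →ₗ[R] M) (n : ℕ) : Prop :=
  Function.Surjective ε ∧ (0 < n → Function.Exact (d 0) ε) ∧
    ∀ i : ℕ, i + 1 < n → Function.Exact (d (i + 1)) (d i)


/-- An exact sequence `0 → C ⊗ P_n → ⋯ → C ⊗ P_1 → C ⊗ P_0 → M → 0`
with each `P_i` projective (encoded by an `ℕ`-indexed complex which vanishes
in degrees `> n`). -/
def HasBoundedExactCRes (R : Type) [CommRing R] (C : Type) [AddCommGroup C] [Module R C]
    (M : Type) [AddCommGroup M] [Module R M] (n : ℕ) : Prop :=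
  ∃ (P : ℕ → ModuleCat.{0} R)
    (d : ∀ i : ℕ, (C ⊗[R] ↥(P (i + 1))) →ₗ[R] (C ⊗[R] ↥(P i)))
    (ε : (C ⊗[R] ↥(P 0)) →ₗ[R] M),
      (∀ i, Module.Projective R ↥(P i)) ∧ ResExact R C M P d ε ∧
      ∀ i, n < i → Subsingleton (C ⊗[R] ↥(P i))

/-- `M` has finite `P_C`-projective dimension. -/
def HasFinCPd (R : Type) [CommRing R] (C : Type) [AddCommGroup C] [Module R C]
    (M : Type) [AddCommGroup M] [Module R M] : Prop :=
  ∃ n : ℕ, HasBoundedExactCRes R C M n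

/-- `M` has projective dimension at most `n`: there is an exact sequence
`0 → Q_n → ⋯ → Q_0 → M → 0` with each `Q_i` projective. -/
def HasProjDimLE (R : Type) [CommRing R] (M : Type) [AddCommGroup M] [Module R M]
    (n : ℕ) : Prop :=
  ∃ (Q : ℕ → ModuleCat.{0} R) (d : ∀ i : ℕ, ↥(Q (i + 1)) →ₗ[R] ↥(Q i))
    (ε : ↥(Q 0) →ₗ[R] M),
      (∀ i, Module.Projective R ↥(Q i)) ∧ Function.Surjective ε ∧
      Function.Exact (d 0) ε ∧ (∀ i, Function.Exact (d (i + 1)) (d i)) ∧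
      ∀ i, n < i → Subsingleton ↥(Q i)

/-- `M` has injective dimension at most `n`: there is an exact sequence
`0 → M → I⁰ → ⋯ → Iⁿ → 0` with each `I^j` injective. -/
def HasInjDimLE (R : Type) [CommRing R] (M : Type) [AddCommGroup M] [Module R M]
    (n : ℕ) : Prop :=
  ∃ (I : ℕ → ModuleCat.{0} R) (δ : ∀ j : ℕ, ↥(I j) →ₗ[R] ↥(I (j + 1)))
    (ι : M →ₗ[R] ↥(I 0)),
      (∀ j, Module.Injective R ↥(I j)) ∧ Function.Injective ι ∧
      Function.Exact ι (δ 0) ∧ (∀ j, Function.Exact (δ j) (δ (j + 1))) ∧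
      ∀ j, n < j → Subsingleton ↥(I j)


section Helpers

variable {R : Type} [CommRing R] {C : Type} [AddCommGroup C] [Module R C]

lemma muMap_finsupp_bij (hfin : Module.Finite R C)
    (hb : Function.Bijective (fun r : R => (r • LinearMap.id : C →ₗ[R] C))) (ι : Type) :
    Function.Bijective (muMap R C (ι →₀ R)) := by
  classical
  let e := TensorProduct.finsuppScalarRight R R C ι
  have he : ∀ (x : ι →₀ R) (c : C) (i : ι), e (muMap R C (ι →₀ R) x c) i = x i • c := by
    intro x c i
    exact TensorProduct.finsuppScalarRight_apply_tmul_apply c x i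
  constructor
  · intro x y hxy
    ext i
    apply hb.1
    ext c
    have := he x c i
    rw [hxy, he y c i] at this
    simpa using this.symm
  · intro f
    have h1 : ∀ i : ι, ∃ r : R, (r • LinearMap.id : C →ₗ[R] C) =
        (Finsupp.lapply i).comp (e.toLinearMap.comp f) := fun i => hb.2 _
    choose r hr using h1
    have hr' : ∀ i c, e (f c) i = r i • c := by
      intro i c
      have := LinearMap.congr_fun (hr i) c
      simpa using this.symm
    obtain ⟨S, hS⟩ := hfin.fg_top
    have hsupp : ∀ i, r i ≠ 0 → i ∈ S.biUnion (fun c => (e (f c)).support) := by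
      intro i hi
      by_contra hn
      apply hi
      apply hb.1
      change (r i • LinearMap.id : C →ₗ[R] C) = (0 : R) • LinearMap.id
      apply LinearMap.ext_on hS
      intro c hc
      have : e (f c) i = 0 := by
        by_contra h0
        exact hn (Finset.mem_biUnion.2 ⟨c, hc, Finsupp.mem_support_iff.2 h0⟩)
      rw [hr'] at this
      simpa using this
    refine ⟨Finsupp.onFinset _ r hsupp, ?_⟩
    ext c
    apply e.injective
    ext i
    rw [he, hr']
    rfl

lemma muMap_natural {P Q : Type} [AddCommGroup P] [Module R P] [AddCommGroup Q] [Module R Q]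
    (f : P →ₗ[R] Q) (p : P) :
    muMap R C Q (f p) = (f.lTensor C).comp (muMap R C P p) := by
  ext c
  simp [muMap]

lemma muMap_proj_bij (hfin : Module.Finite R C)
    (hb : Function.Bijective (fun r : R => (r • LinearMap.id : C →ₗ[R] C)))
    (P : Type) [AddCommGroup P] [Module R P] [Module.Projective R P] :
    Function.Bijective (muMap R C P) := by
  obtain ⟨s, hs⟩ := Module.projective_def'.1 (inferInstance : Module.Projective R P)
  have hF := muMap_finsupp_bij hfin hb P
  have hs' : ∀ p, Finsupp.linearCombination R id (s p) = p := fun p => LinearMap.congr_fun hs p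
  constructor
  · intro x y hxy
    have : s x = s y := by
      apply hF.1
      rw [muMap_natural, muMap_natural, hxy]
    rw [← hs' x, this, hs']
  · intro g
    obtain ⟨x, hx⟩ := hF.2 ((s.lTensor C).comp g)
    refine ⟨Finsupp.linearCombination R id x, ?_⟩
    rw [muMap_natural, hx, ← LinearMap.comp_assoc, ← LinearMap.lTensor_comp, hs]
    simp

/-- The projective resolution built from a linear exact sequence. -/
lemma tor_exact (N : Type) [AddCommGroup N] [Module R N]
    (hT : ∀ i : ℕ, 1 ≤ i → Subsingleton (torMod R C N i))
    (P : ℕ → ModuleCat.{0} R) (hP : ∀ n, Module.Projective R (P n))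
    (δ : ∀ n, (P (n + 1)) →ₗ[R] (P n)) (π : (P 0) →ₗ[R] N)
    (hπ : Function.Surjective π) (h0 : Function.Exact (δ 0) π)
    (hδ : ∀ n, Function.Exact (δ (n + 1)) (δ n)) (n : ℕ) :
    Function.Exact ((δ (n + 1)).lTensor C) ((δ n).lTensor C) := by
  have sq : ∀ n, ModuleCat.ofHom (δ (n + 1)) ≫ ModuleCat.ofHom (δ n) = 0 := by
    intro n
    ext x
    exact (hδ n).apply_apply_eq_zero x
  let K : ChainComplex (ModuleCat.{0} R) ℕ :=
    ChainComplex.of P (fun n => ModuleCat.ofHom (δ n)) sq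
  have hd : ∀ n, K.d (n + 1) n = ModuleCat.ofHom (δ n) := fun n =>
    ChainComplex.of_d P (fun n => ModuleCat.ofHom (δ n)) n
  have hz : K.d 1 0 ≫ (ModuleCat.ofHom π : K.X 0 ⟶ ModuleCat.of R N) = 0 := by
    rw [hd 0]
    ext x
    exact h0.apply_apply_eq_zero x
  have hex : ∀ n, K.ExactAt (n + 1) := by
    intro n
    rw [HomologicalComplex.exactAt_iff' _ (n + 1 + 1) (n + 1) n (by simp) (by simp)]
    rw [ShortComplex.ShortExact.moduleCat_exact_iff_function_exact]
    change Function.Exact (K.d (n + 1 + 1) (n + 1)) (K.d (n + 1) n)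
    rw [hd, hd]
    exact hδ n
  let ρ : K ⟶ (ChainComplex.single₀ (ModuleCat.{0} R)).obj (ModuleCat.of R N) :=
    (ChainComplex.toSingle₀Equiv _ _).symm ⟨ModuleCat.ofHom π, hz⟩
  have hq : QuasiIso ρ := ⟨fun n => by
    cases n
    · rw [ChainComplex.quasiIsoAt₀_iff, ShortComplex.quasiIso_iff_of_zeros']
      · constructor
        · rw [ShortComplex.ShortExact.moduleCat_exact_iff_function_exact]
          change Function.Exact (K.d 1 0) (ρ.f 0)
          rw [ChainComplex.toSingle₀Equiv_symm_apply_f_zero, hd 0]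
          exact h0
        · change Epi (ρ.f 0)
          rw [ChainComplex.toSingle₀Equiv_symm_apply_f_zero]
          exact (ModuleCat.epi_iff_surjective _).2 hπ
      all_goals rfl
    · rw [quasiIsoAt_iff_exactAt']
      · apply hex
      · apply ChainComplex.exactAt_succ_single_obj⟩
  let res : ProjectiveResolution (ModuleCat.of R N) :=
    { complex := K
      projective := fun n => (IsProjective.iff_projective (P n)).1 (hP n)
      π := ρ
      quasiIso := hq }
  let F := (MonoidalCategory.tensoringLeft (ModuleCat.{0} R)).obj (ModuleCat.of R C)
  have i1 := res.isoLeftDerivedObj F (n + 1)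
  have z1 : Limits.IsZero ((F.leftDerived (n + 1)).obj (ModuleCat.of R N)) := by
    have := hT (n + 1) (by omega)
    exact @ModuleCat.isZero_of_subsingleton R _ _ this
  have z2 := z1.of_iso i1.symm
  have z3 : ((F.mapHomologicalComplex _).obj K).ExactAt (n + 1) :=
    (HomologicalComplex.exactAt_iff_isZero_homology _ _).2 z2
  rw [HomologicalComplex.exactAt_iff' _ (n + 1 + 1) (n + 1) n (by simp) (by simp),
    ShortComplex.ShortExact.moduleCat_exact_iff_function_exact] at z3
  change Function.Exact (F.map (K.d (n + 1 + 1) (n + 1))) (F.map (K.d (n + 1) n)) at z3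
  rw [hd, hd] at z3
  exact z3

end Helpers

/-- If `M` is in the Bass class `B_C`, then every augmented proper `P_C`-projective
resolution of `M` is exact; in particular every `P_C`-precover of `M` is surjective. -/
theorem bassClass_augProperRes_exact
    (R : Type) [CommRing R] (C : Type) [AddCommGroup C] [Module R C]
    (M : Type) [AddCommGroup M] [Module R M] (hC : IsSemidualizing R C)
    (hM : MemBassClass R C M) :
    (∀ (P : ℕ → ModuleCat.{0} R)
        (d : ∀ k : ℕ, (C ⊗[R] ↥(P (k + 1))) →ₗ[R] (C ⊗[R] ↥(P k)))
        (ε : (C ⊗[R] ↥(P 0)) →ₗ[R] M),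
          IsAugProperRes R C M P d ε → ResExact R C M P d ε) ∧
    (∀ (P : Type) [AddCommGroup P] [Module R P], Module.Projective R P →
      ∀ φ : (C ⊗[R] P) →ₗ[R] M,
        (∀ (Q : Type) [AddCommGroup Q] [Module R Q], Module.Projective R Q →
          Function.Surjective (fun g : (C ⊗[R] Q) →ₗ[R] (C ⊗[R] P) => φ.comp g)) →
        Function.Surjective φ) := by
  have hfin : Module.Finite R C := by
    obtain ⟨⟨P, d, ε, hf, -, hs, -⟩, -⟩ := hC
    have := hf 0
    exact Module.Finite.of_surjective ε hs
  have hb := hC.2.1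
  have key : ∀ (P : Type) [AddCommGroup P] [Module R P] (φ : (C ⊗[R] P) →ₗ[R] M),
      φ = (evalNu R C M).comp ((φ.compRight R ∘ₗ muMap R C P).lTensor C) := by
    intro P _ _ φ
    ext c p
    simp [evalNu, muMap]
  have surj : ∀ (P : Type) [AddCommGroup P] [Module R P], Module.Projective R P →
      ∀ φ : (C ⊗[R] P) →ₗ[R] M,
        (∀ (Q : Type) [AddCommGroup Q] [Module R Q], Module.Projective R Q →
          Function.Surjective (fun g : (C ⊗[R] Q) →ₗ[R] (C ⊗[R] P) => φ.comp g)) →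
        Function.Surjective (φ.compRight R ∘ₗ muMap R C P) := by
    intro P _ _ hP φ h f
    obtain ⟨g, hg⟩ := h R inferInstance (f.comp (TensorProduct.rid R C).toLinearMap)
    obtain ⟨p, hp⟩ := (muMap_proj_bij hfin hb P).2
      (g.comp (TensorProduct.rid R C).symm.toLinearMap)
    refine ⟨p, ?_⟩
    change φ.comp (muMap R C P p) = f
    rw [hp, ← LinearMap.comp_assoc]
    ext c
    have := LinearMap.congr_fun hg (c ⊗ₜ 1)
    simpa using this
  refine ⟨?_, ?_⟩
  · rintro P d ε ⟨hP, -, -, hX⟩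
    have mu := fun n => muMap_proj_bij hfin hb (P n)
    let e : ∀ n, (P n) ≃ₗ[R] (C →ₗ[R] C ⊗[R] (P n)) :=
      fun n => LinearEquiv.ofBijective (muMap R C (P n)) (mu n)
    let δ : ∀ n, (P (n + 1)) →ₗ[R] (P n) := fun n =>
      (e n).symm.toLinearMap ∘ₗ (d n).compRight R ∘ₗ (e (n + 1)).toLinearMap
    let π : (P 0) →ₗ[R] (C →ₗ[R] M) := ε.compRight R ∘ₗ muMap R C (P 0)
    have hδ : ∀ n p, muMap R C (P n) (δ n p) = (d n).comp (muMap R C (P (n + 1)) p) := by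
      intro n p
      exact (e n).apply_symm_apply _
    have hd : ∀ n, d n = (δ n).lTensor C := by
      intro n
      ext c p
      exact (LinearMap.congr_fun (hδ n p) c).symm
    -- exactness of `Hom(C, -)` from that of `Hom(C ⊗ R, -)`
    have tr : ∀ {X Y Z : Type} [AddCommGroup X] [Module R X] [AddCommGroup Y] [Module R Y]
        [AddCommGroup Z] [Module R Z] (f : X →ₗ[R] Y) (g : Y →ₗ[R] Z),
        Function.Exact (fun u : (C ⊗[R] R) →ₗ[R] X => f.comp u)
          (fun u : (C ⊗[R] R) →ₗ[R] Y => g.comp u) →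
        ∀ v : C →ₗ[R] Y, g.comp v = 0 ↔ ∃ u : C →ₗ[R] X, f.comp u = v := by
      intro X Y Z _ _ _ _ _ _ f g h v
      constructor
      · intro hv
        obtain ⟨u, hu⟩ := (h (v.comp (TensorProduct.rid R C).toLinearMap)).1
          (by change g.comp _ = 0; rw [← LinearMap.comp_assoc, hv, LinearMap.zero_comp])
        refine ⟨u.comp (TensorProduct.rid R C).symm.toLinearMap, ?_⟩
        ext c
        have := LinearMap.congr_fun hu (c ⊗ₜ 1)
        simpa using this
      · rintro ⟨u, rfl⟩
        have := (h ((f.comp u).comp (TensorProduct.rid R C).toLinearMap)).2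
          ⟨u.comp (TensorProduct.rid R C).toLinearMap, rfl⟩
        ext c
        have := LinearMap.congr_fun this (c ⊗ₜ 1)
        simpa using this
    obtain ⟨-, hX0, hXn⟩ := hX R inferInstance
    have hπ : Function.Surjective π :=
      surj (P 0) (hP 0) ε (fun Q _ _ hQ => (hX Q hQ).1)
    have ex0 : Function.Exact (δ 0) π := by
      intro p
      change ε.comp (muMap R C (P 0) p) = 0 ↔ _
      rw [tr _ _ hX0]
      constructor
      · rintro ⟨u, hu⟩
        obtain ⟨q, rfl⟩ := (mu 1).2 u
        exact ⟨q, (mu 0).1 ((hδ 0 q).trans hu)⟩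
      · rintro ⟨q, rfl⟩
        exact ⟨muMap R C (P 1) q, (hδ 0 q).symm⟩
    have exn : ∀ n, Function.Exact (δ (n + 1)) (δ n) := by
      intro n p
      rw [← map_eq_zero_iff _ (mu n).1, hδ, tr _ _ (hXn n)]
      constructor
      · rintro ⟨u, hu⟩
        obtain ⟨q, rfl⟩ := (mu (n + 2)).2 u
        exact ⟨q, (mu (n + 1)).1 ((hδ (n + 1) q).trans hu)⟩
      · rintro ⟨q, rfl⟩
        exact ⟨muMap R C (P (n + 2)) q, (hδ (n + 1) q).symm⟩
    have hε : ε = (evalNu R C M).comp (π.lTensor C) := key (P 0) ε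
    refine ⟨?_, ?_, ?_⟩
    · rw [hε]
      exact hM.2.2.2.comp (LinearMap.lTensor_surjective C hπ)
    · intro x
      rw [hε, hd 0, ← lTensor_exact C ex0 hπ x]
      exact map_eq_zero_iff _ hM.2.2.1
    · intro n
      rw [hd, hd]
      exact tor_exact _ hM.2.1 P hP δ π hπ ex0 exn n
  · intro P _ _ hP φ h
    rw [key P φ]
    exact hM.2.2.2.comp (LinearMap.lTensor_surjective C (surj P hP φ h))

end
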